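/- For all points a, b ∈ EuclideanSpace ℝ (Fin 2), headings α, β ∈ ℝ, and every minimum turning radius r_min > 0, there exists L₀ > 0 such that for every l ≥ L₀ there is a feasible trajectory of length exactly l from the oriented point (a, α) to the oriented point (b, β). That is, all sufficiently large lengths are reachable by curvature-bounded trajectories between any two oriented points. -/

import Mathlib

/-- The point of the Euclidean plane with coordinates `(x, y)`. -/
noncomputable def planePt (x y : ℝ) : EuclideanSpace ℝ (Fin 2) :=
  (WithLp.equiv 2 (Fin 2 → ℝ)).symm ![x, y]

/-- A feasible curvature-bounded trajectory of length `s` from the oriented point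
`(a, α)` to the oriented point `(b, β)`: a unit-speed `C¹` path `Λ` with velocity `v`,
matching endpoints and headings, whose velocity is `(1/r_min)`-Lipschitz on `[0, s]`
(the curvature bound `‖Λ''‖ ≤ 1/r_min`). -/
def FeasibleTrajectory (a b : EuclideanSpace ℝ (Fin 2)) (α β : ℝ) (r_min s : ℝ)
    (Λ v : ℝ → EuclideanSpace ℝ (Fin 2)) : Prop :=
  (∀ t ∈ Set.Icc (0 : ℝ) s, HasDerivAt Λ (v t) t) ∧
  (∀ t ∈ Set.Icc (0 : ℝ) s, ‖v t‖ = 1) ∧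
  Λ 0 = a ∧ Λ s = b ∧
  v 0 = planePt (Real.cos α) (Real.sin α) ∧
  v s = planePt (Real.cos β) (Real.sin β) ∧
  LipschitzOnWith (1 / r_min).toNNReal v (Set.Icc (0 : ℝ) s)

/-- A heading function with rate of change at most `κ` leading from heading `α` to heading `β` in
time `s`, along which the unit-speed path is displaced by `(x, y)`. -/
def HeadingReach (κ α β x y s : ℝ) : Prop :=
  ∃ θ : ℝ → ℝ, (∀ u t, u ≤ t → |θ t - θ u| ≤ κ * (t - u)) ∧ 0 ≤ s ∧ θ 0 = α ∧ θ s = β ∧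
    (∫ t in (0 : ℝ)..s, Real.cos (θ t)) = x ∧ (∫ t in (0 : ℝ)..s, Real.sin (θ t)) = y

theorem abs_sub_le_mul_abs_sub {κ : ℝ} {θ : ℝ → ℝ}
    (h : ∀ u t, u ≤ t → |θ t - θ u| ≤ κ * (t - u)) (u t : ℝ) : |θ u - θ t| ≤ κ * |u - t| := by
  rcases le_total u t with hut | hut
  · rw [abs_sub_comm, abs_sub_comm u, abs_of_nonneg (sub_nonneg.2 hut)]
    exact h u t hut
  · rw [abs_of_nonneg (sub_nonneg.2 hut)]
    exact h t u hut

theorem continuous_of_abs_sub_le {κ : ℝ} {θ : ℝ → ℝ}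
    (h : ∀ u t, u ≤ t → |θ t - θ u| ≤ κ * (t - u)) : Continuous θ := by
  refine (LipschitzWith.of_dist_le_mul (K := κ.toNNReal) fun u t => ?_).continuous
  rw [Real.dist_eq, Real.dist_eq]
  exact (abs_sub_le_mul_abs_sub h u t).trans
    (mul_le_mul_of_nonneg_right (Real.le_coe_toNNReal _) (abs_nonneg _))

theorem intervalIntegral_comp_glue {f θ₁ θ₂ : ℝ → ℝ} (hf : Continuous f) (h₁ : Continuous θ₁)
    (h₂ : Continuous θ₂) {s₁ s₂ : ℝ} (hs₁ : 0 ≤ s₁) (hs₂ : 0 ≤ s₂) (h : θ₁ s₁ = θ₂ 0) :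
    (∫ t in (0 : ℝ)..(s₁ + s₂), f (if t ≤ s₁ then θ₁ t else θ₂ (t - s₁))) =
      (∫ t in (0 : ℝ)..s₁, f (θ₁ t)) + ∫ t in (0 : ℝ)..s₂, f (θ₂ t) := by
  have hc : Continuous fun t => f (if t ≤ s₁ then θ₁ t else θ₂ (t - s₁)) := by
    refine hf.comp (Continuous.if_le h₁ (by fun_prop) continuous_id continuous_const ?_)
    rintro t rfl
    simpa using h
  rw [← intervalIntegral.integral_add_adjacent_intervals (b := s₁)
    (hc.intervalIntegrable _ _) (hc.intervalIntegrable _ _)]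
  congr 1
  · refine intervalIntegral.integral_congr fun t ht => ?_
    rw [Set.uIcc_of_le hs₁] at ht
    simp [ht.2]
  · have : (∫ t in s₁..(s₁ + s₂), f (if t ≤ s₁ then θ₁ t else θ₂ (t - s₁))) =
        ∫ t in s₁..(s₁ + s₂), f (θ₂ (t - s₁)) := by
      refine intervalIntegral.integral_congr fun t ht => ?_
      rw [Set.uIcc_of_le (by linarith)] at ht
      rcases ht.1.eq_or_lt with rfl | hlt
      · simp [h]
      · simp [not_le.2 hlt]
    rw [this, intervalIntegral.integral_comp_sub_right (fun t => f (θ₂ t))]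
    simp

theorem HeadingReach.trans {κ α β γ x y x' y' s s' : ℝ} (h : HeadingReach κ α β x y s)
    (h' : HeadingReach κ β γ x' y' s') : HeadingReach κ α γ (x + x') (y + y') (s + s') := by
  obtain ⟨θ₁, hl₁, hs₁, h0₁, he₁, hx₁, hy₁⟩ := h
  obtain ⟨θ₂, hl₂, hs₂, h0₂, he₂, hx₂, hy₂⟩ := h'
  have hglue : θ₁ s = θ₂ 0 := he₁.trans h0₂.symm
  have c₁ := continuous_of_abs_sub_le hl₁
  have c₂ := continuous_of_abs_sub_le hl₂
  refine ⟨fun t => if t ≤ s then θ₁ t else θ₂ (t - s), fun u t hut => ?_, by positivity, ?_, ?_,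
    ?_, ?_⟩
  · dsimp only
    by_cases ht : t ≤ s
    · rw [if_pos ht, if_pos (hut.trans ht)]
      exact hl₁ u t hut
    · by_cases hu : u ≤ s
      · rw [if_neg ht, if_pos hu]
        have e₁ := hl₁ u s hu
        have e₂ := hl₂ 0 (t - s) (by linarith)
        have e₃ := abs_sub_le (θ₂ (t - s)) (θ₂ 0) (θ₁ u)
        rw [hglue] at e₁
        linarith
      · rw [if_neg ht, if_neg hu]
        have := hl₂ (u - s) (t - s) (by linarith)
        rwa [sub_sub_sub_cancel_right] at this
  · simp [hs₁, h0₁]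
  · rcases hs₂.eq_or_lt with rfl | hlt
    · simp [hglue, he₂]
    · simp [hlt, he₂]
  · rw [intervalIntegral_comp_glue Real.continuous_cos c₁ c₂ hs₁ hs₂ hglue, hx₁, hx₂]
  · rw [intervalIntegral_comp_glue Real.continuous_sin c₁ c₂ hs₁ hs₂ hglue, hy₁, hy₂]

theorem HeadingReach.straight {κ : ℝ} (hκ : 0 ≤ κ) (φ : ℝ) {s : ℝ} (hs : 0 ≤ s) :
    HeadingReach κ φ φ (s * Real.cos φ) (s * Real.sin φ) s :=
  ⟨fun _ => φ, fun u t hut => by simpa using mul_nonneg hκ (sub_nonneg.2 hut), hs, rfl, rfl,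
    by simp, by simp⟩

theorem HeadingReach.arc {κ ω α β : ℝ} (hω : 0 < ω) (hωκ : ω ≤ κ) (hαβ : α ≤ β) :
    HeadingReach κ α β ((Real.sin β - Real.sin α) / ω) ((Real.cos α - Real.cos β) / ω)
      ((β - α) / ω) := by
  have hend : ω * ((β - α) / ω) + α = β := by field_simp; ring
  refine ⟨fun t => ω * t + α, fun u t hut => ?_, div_nonneg (sub_nonneg.2 hαβ) hω.le,
    by simp, hend, ?_, ?_⟩
  · rw [show ω * t + α - (ω * u + α) = ω * (t - u) by ring,
      abs_of_nonneg (mul_nonneg hω.le (sub_nonneg.2 hut))]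
    exact mul_le_mul_of_nonneg_right hωκ (sub_nonneg.2 hut)
  · rw [intervalIntegral.integral_comp_mul_add (fun t => Real.cos t) hω.ne', hend, integral_cos]
    simp [div_eq_inv_mul]
  · rw [intervalIntegral.integral_comp_mul_add (fun t => Real.sin t) hω.ne', hend, integral_sin]
    simp [div_eq_inv_mul]

theorem HeadingReach.loop {κ : ℝ} (hκ : 0 < κ) (α : ℝ) {s : ℝ} (hs : 2 * Real.pi / κ ≤ s) :
    HeadingReach κ α (α + 2 * Real.pi) 0 0 s := by
  have hs0 : 0 < s := lt_of_lt_of_le (by positivity) hs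
  have h := HeadingReach.arc (κ := κ) (ω := 2 * Real.pi / s) (α := α) (β := α + 2 * Real.pi)
    (by positivity) ((div_le_comm₀ hκ hs0).1 hs) (by linarith [Real.pi_pos])
  have hlen : (α + 2 * Real.pi - α) / (2 * Real.pi / s) = s := by
    have := Real.pi_pos
    field_simp
    ring
  rw [hlen] at h
  simpa using h

/-- Every heading modulo `2π` and every displacement can be reached: turn at the maximal rate and insert a
straight segment in the appropriate direction. -/
theorem exists_headingReach {κ : ℝ} (hκ : 0 < κ) (α β x y : ℝ) :
    ∃ (n : ℤ) (s : ℝ), HeadingReach κ α (β + n * (2 * Real.pi)) x y s := by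
  have h2π : 0 < 2 * Real.pi := Real.two_pi_pos
  obtain ⟨n, hn, -⟩ := existsUnique_add_zsmul_mem_Ico h2π β (α + 2 * Real.pi)
  rw [zsmul_eq_mul] at hn
  set β' := β + n * (2 * Real.pi)
  let z : ℂ := ⟨x - (Real.sin β' - Real.sin α) / κ, y - (Real.cos α - Real.cos β') / κ⟩
  obtain ⟨m, hm, -⟩ := existsUnique_add_zsmul_mem_Ico h2π z.arg α
  rw [zsmul_eq_mul] at hm
  have hx : ‖z‖ * Real.cos (z.arg + m * (2 * Real.pi)) =
      x - (Real.sin β' - Real.sin α) / κ := by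
    rw [Real.cos_add_int_mul_two_pi, Complex.norm_mul_cos_arg]
  have hy : ‖z‖ * Real.sin (z.arg + m * (2 * Real.pi)) =
      y - (Real.cos α - Real.cos β') / κ := by
    rw [Real.sin_add_int_mul_two_pi, Complex.norm_mul_sin_arg]
  set φ := z.arg + m * (2 * Real.pi)
  have h := ((HeadingReach.arc hκ le_rfl hm.1).trans
    (HeadingReach.straight hκ.le φ (norm_nonneg z))).trans
    (HeadingReach.arc hκ le_rfl (hm.2.le.trans hn.1))
  rw [hx, hy] at h
  refine ⟨n, (φ - α) / κ + ‖z‖ + (β' - φ) / κ, ?_⟩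
  convert h using 1 <;> ring

theorem norm_planePt (x y : ℝ) : ‖planePt x y‖ = Real.sqrt (x ^ 2 + y ^ 2) := by
  simp [planePt, EuclideanSpace.norm_eq, Fin.sum_univ_two]

theorem planePt_sub (x y x' y' : ℝ) :
    planePt x y - planePt x' y' = planePt (x - x') (y - y') := by
  ext i
  fin_cases i <;> simp [planePt]

theorem norm_planePt_cos_sin_sub_le (p q : ℝ) :
    ‖planePt (Real.cos p) (Real.sin p) - planePt (Real.cos q) (Real.sin q)‖ ≤ |p - q| := by
  rw [planePt_sub, norm_planePt]
  refine Real.sqrt_le_iff.2 ⟨abs_nonneg _, ?_⟩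
  have h := Real.one_sub_sq_div_two_le_cos (x := p - q)
  rw [Real.cos_sub] at h
  rw [sq_abs]
  nlinarith [Real.sin_sq_add_cos_sq p, Real.sin_sq_add_cos_sq q]

theorem hasDerivAt_planePt {f g : ℝ → ℝ} {f' g' t : ℝ} (hf : HasDerivAt f f' t)
    (hg : HasDerivAt g g' t) :
    HasDerivAt (fun u => planePt (f u) (g u)) (planePt f' g') t := by
  have h : ∀ x y, planePt x y = x • planePt 1 0 + y • planePt 0 1 := fun x y => by
    ext i
    fin_cases i <;> simp [planePt]
  rw [h f' g', funext fun u => h (f u) (g u)]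
  exact (hf.smul_const _).add (hg.smul_const _)

theorem HeadingReach.exists_feasibleTrajectory {a b : EuclideanSpace ℝ (Fin 2)}
    {α β r s : ℝ} {n : ℤ}
    (h : HeadingReach (1 / r) α (β + n * (2 * Real.pi)) (b 0 - a 0) (b 1 - a 1) s) :
    ∃ Λ v : ℝ → EuclideanSpace ℝ (Fin 2), FeasibleTrajectory a b α β r s Λ v := by
  obtain ⟨θ, hl, -, h0, he, hx, hy⟩ := h
  have hθ := continuous_of_abs_sub_le hl
  refine ⟨fun t => planePt (a 0 + ∫ u in (0 : ℝ)..t, Real.cos (θ u))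
    (a 1 + ∫ u in (0 : ℝ)..t, Real.sin (θ u)),
    fun t => planePt (Real.cos (θ t)) (Real.sin (θ t)), fun t _ => ?_, fun t _ => ?_, ?_, ?_, ?_,
    ?_, ?_⟩
  · exact hasDerivAt_planePt
      (((Real.continuous_cos.comp hθ).integral_hasStrictDerivAt 0 t).hasDerivAt.const_add _)
      (((Real.continuous_sin.comp hθ).integral_hasStrictDerivAt 0 t).hasDerivAt.const_add _)
  · rw [norm_planePt, Real.cos_sq_add_sin_sq, Real.sqrt_one]
  · ext i
    fin_cases i <;> simp [planePt]
  · ext i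
    fin_cases i <;> simp [planePt, hx, hy]
  · simp [h0]
  · simp only [he, Real.cos_add_int_mul_two_pi, Real.sin_add_int_mul_two_pi]
  · refine (LipschitzWith.of_dist_le_mul fun u t => ?_).lipschitzOnWith
    rw [dist_eq_norm, Real.dist_eq]
    refine (norm_planePt_cos_sin_sub_le _ _).trans ?_
    exact (abs_sub_le_mul_abs_sub hl u t).trans
      (mul_le_mul_of_nonneg_right (Real.le_coe_toNNReal _) (abs_nonneg _))

/-- Between any two oriented points of the plane and for any minimum turning radius
`r_min > 0`, all sufficiently large lengths are reachable: there is an `L₀ > 0` such that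
for every `l ≥ L₀` a feasible curvature-bounded trajectory of length exactly `l` exists. -/
theorem all_large_lengths_reachable
    (a b : EuclideanSpace ℝ (Fin 2)) (α β : ℝ) (r_min : ℝ) (hr : 0 < r_min) :
    ∃ L₀ > (0 : ℝ), ∀ l ≥ L₀, ∃ Λ v : ℝ → EuclideanSpace ℝ (Fin 2),
      FeasibleTrajectory a b α β r_min l Λ v := by
  have hκ : 0 < 1 / r_min := by positivity
  obtain ⟨n, s, h⟩ := exists_headingReach hκ α β (b 0 - a 0) (b 1 - a 1)
  have hs : 0 ≤ s := h.choose_spec.2.1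
  refine ⟨s + 2 * Real.pi / (1 / r_min), by positivity, fun l hl => ?_⟩
  have h' := h.trans (HeadingReach.loop hκ _ (s := l - s) (by linarith))
  refine HeadingReach.exists_feasibleTrajectory (n := n + 1) ?_
  convert h' using 1
  · push_cast
    ring
  all_goals ring
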